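/- arXiv:0805.2710 — 3 statements merged into one kernel-verified Lean document; each statement's English description precedes it below -/
import Mathlib

section
/- For any continuous map f : M → M, the set 𝒪 of all observable probability measures of f is nonempty and weak*-compact, and every observable measure is f-invariant. -/
open MeasureTheory Filter Set Topology
open scoped ENNReal NNReal

/-- A metric on a topological space `P` (here: the space `𝒫` of Borel probability
measures with the weak* topology) inducing its topology; `d` plays the role of `dist*`. -/
structure CompatibleMetric (P : Type*) [TopologicalSpace P] where
  d : P → P → ℝ
  symm : ∀ x y, d x y = d y x
  triangle : ∀ x y z, d x z ≤ d x y + d y z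
  eq_iff_dist_eq_zero : ∀ x y, d x y = 0 ↔ x = y
  nhds_iff : ∀ (x : P) (s : Set P), s ∈ nhds x ↔ ∃ ε > 0, {y | d x y < ε} ⊆ s

/-- The diameter of a set of measures w.r.t. the metric `D.d`. -/
noncomputable def diamD {P : Type*} [TopologicalSpace P] (D : CompatibleMetric P)
    (A : Set P) : ℝ :=
  sSup (Set.image2 D.d A A)

variable {M : Type*} [MeasurableSpace M] [TopologicalSpace M] [OpensMeasurableSpace M]

/-- The empirical measure `σ_{n+1,x} = (1/(n+1)) ∑_{j=0}^{n} δ_{f^j(x)}`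
(index shifted so that it is defined for every `n : ℕ`). -/
noncomputable def empiric (f : M → M) (x : M) (n : ℕ) : ProbabilityMeasure M :=
  ⟨((n : ℝ≥0∞) + 1)⁻¹ • ∑ j ∈ Finset.range (n + 1), Measure.dirac (f^[j] x), by
    constructor
    rw [Measure.smul_apply, Measure.finset_sum_apply]
    simp only [measure_univ, Finset.sum_const, Finset.card_range, nsmul_eq_mul, mul_one,
      smul_eq_mul]
    rw [Nat.cast_add, Nat.cast_one]
    exact ENNReal.inv_mul_cancel (by simp)
      (ENNReal.add_ne_top.2 ⟨ENNReal.natCast_ne_top n, ENNReal.one_ne_top⟩)⟩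

/-- `pω(x)`: the set of weak* limit points of the sequence of empirical measures
of the orbit of `x`. -/
def pomega (f : M → M) (x : M) : Set (ProbabilityMeasure M) :=
  {μ | MapClusterPt μ atTop (empiric f x)}

/-- The basin of attraction `B(K) = {x : pω(x) ⊆ K}` of a set of probability measures. -/
def basin (f : M → M) (K : Set (ProbabilityMeasure M)) : Set M :=
  {x | pomega f x ⊆ K}

/-- `μ` is observable: for all `ε > 0` the `ε`-basin of partial attraction
`A_ε(μ) = {x : dist*(pω(x), μ) < ε}` has positive `m`-measure. -/
def Observable (D : CompatibleMetric (ProbabilityMeasure M)) (m : Measure M)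
    (f : M → M) (μ : ProbabilityMeasure M) : Prop :=
  ∀ ε > 0, 0 < m {x | ∃ ν ∈ pomega f x, D.d ν μ < ε}

/-- `μ` is a physical measure: its basin `{x : pω(x) = {μ}}` has positive `m`-measure. -/
def PhysicalMeasure (m : Measure M) (f : M → M) (μ : ProbabilityMeasure M) : Prop :=
  0 < m {x | pomega f x = {μ}}

/-- A generalized attractor (reduction of the set `𝒪` of observable measures): a nonempty
weak*-compact set of observable measures whose basin has positive `m`-measure. -/
def GenAttractor (D : CompatibleMetric (ProbabilityMeasure M)) (m : Measure M)
    (f : M → M) (A : Set (ProbabilityMeasure M)) : Prop :=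
  A.Nonempty ∧ IsCompact A ∧ (∀ μ ∈ A, Observable D m f μ) ∧ 0 < m (basin f A)

/-- Two generalized attractors are independent if the basin of their intersection is null. -/
def IndepGA (m : Measure M) (f : M → M) (A B : Set (ProbabilityMeasure M)) : Prop :=
  m (basin f (A ∩ B)) = 0

/-- A co-chain: an (at most countable) family of pairwise independent generalized attractors. -/
def IsCochain (D : CompatibleMetric (ProbabilityMeasure M)) (m : Measure M) (f : M → M)
    (S : Set (Set (ProbabilityMeasure M))) : Prop :=
  S.Countable ∧ (∀ A ∈ S, GenAttractor D m f A) ∧ S.Pairwise (IndepGA m f)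

/-- A chain: a (finite or countably infinite) sequence, indexed by `I ⊆ ℕ`, of generalized
attractors that is strictly decreasing under inclusion. -/
def IsChainGA (D : CompatibleMetric (ProbabilityMeasure M)) (m : Measure M) (f : M → M)
    (I : Set ℕ) (c : ℕ → Set (ProbabilityMeasure M)) : Prop :=
  I.Nonempty ∧ (∀ i ∈ I, GenAttractor D m f (c i)) ∧
    ∀ i ∈ I, ∀ j ∈ I, j < i → c i ⊂ c j

/-- Two chains are independent if each contains a member independent of some member
of the other. -/
def IndepChainPair (m : Measure M) (f : M → M)
    (p q : Set ℕ × (ℕ → Set (ProbabilityMeasure M))) : Prop :=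
  (∃ i ∈ p.1, ∃ j ∈ q.1, IndepGA m f (p.2 i) (q.2 j)) ∧
    (∃ j ∈ q.1, ∃ i ∈ p.1, IndepGA m f (q.2 j) (p.2 i))

/-- `k`: the supremum of the lengths (cardinalities) of co-chains of generalized attractors. -/
noncomputable def cochainSup (D : CompatibleMetric (ProbabilityMeasure M)) (m : Measure M)
    (f : M → M) : Cardinal :=
  sSup {c : Cardinal | ∃ S, IsCochain D m f S ∧ c = Cardinal.mk S}

/-- `h`: the supremum of the cardinalities of (at most countable) families of pairwise
independent chains of generalized attractors. -/
noncomputable def indepChainFamilySup (D : CompatibleMetric (ProbabilityMeasure M))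
    (m : Measure M) (f : M → M) : Cardinal :=
  sSup {c : Cardinal | ∃ F : Set (Set ℕ × (ℕ → Set (ProbabilityMeasure M))),
    F.Countable ∧ (∀ p ∈ F, IsChainGA D m f p.1 p.2) ∧ F.Pairwise (IndepChainPair m f) ∧
    c = Cardinal.mk F}

/-- An irreducible generalized attractor: one containing no proper compact subset that is
itself a generalized attractor. -/
def IrreducibleGA (D : CompatibleMetric (ProbabilityMeasure M)) (m : Measure M) (f : M → M)
    (A : Set (ProbabilityMeasure M)) : Prop :=
  GenAttractor D m f A ∧ ∀ K, IsCompact K → K ⊂ A → ¬ GenAttractor D m f K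

namespace CompatibleMetric

variable {P : Type*} [TopologicalSpace P] (D : CompatibleMetric P)

theorem ball_mem_nhds (x : P) {ε : ℝ} (hε : 0 < ε) : {y | D.d y x < ε} ∈ 𝓝 x :=
  (D.nhds_iff x _).2 ⟨ε, hε, fun y hy => (D.symm y x).trans_lt hy⟩

theorem mem_closure_of_forall_exists_lt {s : Set P} {x : P}
    (h : ∀ ε > 0, ∃ y ∈ s, D.d y x < ε) : x ∈ closure s := by
  refine mem_closure_iff_nhds.2 fun t ht => ?_
  obtain ⟨ε, hε, hεt⟩ := (D.nhds_iff x t).1 ht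
  obtain ⟨y, hys, hy⟩ := h ε hε
  exact ⟨y, hεt ((D.symm x y).trans_lt hy), hys⟩

end CompatibleMetric

theorem MapClusterPt.eq_of_tendsto {ι X : Type*} [TopologicalSpace X] [T2Space X]
    {l : Filter ι} {u : ι → X} {a b : X} (ha : MapClusterPt a l u) (hb : Tendsto u l (𝓝 b)) :
    a = b :=
  haveI : NeBot (𝓝 a ⊓ map u l) := ha
  eq_of_nhds_neBot (NeBot.mono this (inf_le_inf_left _ hb))

theorem isClosed_setOf_observable (D : CompatibleMetric (ProbabilityMeasure M)) (m : Measure M)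
    (f : M → M) : IsClosed {μ : ProbabilityMeasure M | Observable D m f μ} := by
  refine isClosed_of_closure_subset fun μ hμ ε hε => ?_
  obtain ⟨ν, hνμ, hν⟩ := mem_closure_iff_nhds.1 hμ _ (D.ball_mem_nhds μ (half_pos hε))
  refine (hν (ε / 2) (half_pos hε)).trans_le (measure_mono ?_)
  rintro x ⟨ρ, hρ, hρν⟩
  refine ⟨ρ, hρ, (D.triangle ρ ν μ).trans_lt ?_⟩
  have : D.d ν μ < ε / 2 := hνμ
  linarith

theorem pomega_nonempty [CompactSpace (ProbabilityMeasure M)] (f : M → M) (x : M) :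
    (pomega f x).Nonempty :=
  exists_clusterPt_of_compactSpace _

theorem exists_observable [CompactSpace (ProbabilityMeasure M)]
    (D : CompatibleMetric (ProbabilityMeasure M)) (m : Measure M) [NeZero m] (f : M → M) :
    ∃ μ : ProbabilityMeasure M, Observable D m f μ := by
  by_contra! h
  simp only [Observable, not_forall, not_lt, nonpos_iff_eq_zero] at h
  choose ε hε hnull using h
  obtain ⟨t, -, ht⟩ := isCompact_univ.elim_nhds_subcover
    (fun μ : ProbabilityMeasure M => {ν | D.d ν μ < ε μ}) fun μ _ => D.ball_mem_nhds μ (hε μ)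
  refine NeZero.ne (m univ) (measure_mono_null (fun x _ => ?_)
    ((measure_biUnion_null_iff t.countable_toSet).2 fun μ _ => hnull μ))
  obtain ⟨ν, hν⟩ := pomega_nonempty f x
  obtain ⟨μ, hμ, hνμ⟩ := mem_iUnion₂.1 (ht (mem_univ ν))
  exact mem_iUnion₂.2 ⟨μ, hμ, ν, hν, hνμ⟩

theorem integral_empiric (f : M → M) (x : M) (n : ℕ) {g : M → ℝ} (hg : Continuous g) :
    ∫ y, g y ∂(empiric f x n : Measure M) =
      ((n : ℝ) + 1)⁻¹ * ∑ j ∈ Finset.range (n + 1), g (f^[j] x) := by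
  have hdirac (a : M) : ∫ y, g y ∂(Measure.dirac a) = g a :=
    integral_dirac' g a hg.stronglyMeasurable
  change ∫ y, g y ∂(((n : ℝ≥0∞) + 1)⁻¹ • ∑ j ∈ Finset.range (n + 1),
    Measure.dirac (f^[j] x)) = _
  rw [integral_smul_measure, integral_finsetSum_measure]
  · simp only [hdirac, smul_eq_mul, ENNReal.toReal_inv]
    rw [ENNReal.toReal_add (ENNReal.natCast_ne_top n) ENNReal.one_ne_top]
    simp
  · exact fun j _ => integrable_dirac' hg.stronglyMeasurable (by simp)

theorem tendsto_integral_empiric_comp_sub {f : M → M} (hf : Continuous f) (x : M)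
    (g : BoundedContinuousFunction M ℝ) :
    Tendsto (fun n => ∫ y, g (f y) ∂(empiric f x n : Measure M) -
      ∫ y, g y ∂(empiric f x n : Measure M)) atTop (𝓝 0) := by
  have h (n : ℕ) : ∫ y, g (f y) ∂(empiric f x n : Measure M) -
      ∫ y, g y ∂(empiric f x n : Measure M) =
      (1 / ((n : ℝ) + 1)) * (g (f^[n + 1] x) - g x) := by
    rw [integral_empiric f x n (g := fun y => g (f y)) (g.continuous.comp hf),
      integral_empiric f x n g.continuous,
      ← mul_sub, ← Finset.sum_sub_distrib, one_div]
    simp only [← Function.iterate_succ_apply']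
    rw [Finset.sum_range_sub fun j => g (f^[j] x)]
    rfl
  simp only [h]
  refine tendsto_one_div_add_atTop_nhds_zero_nat.zero_mul_isBoundedUnder_le
    (isBoundedUnder_of ⟨‖g‖ + ‖g‖, fun n => ?_⟩)
  exact (norm_sub_le _ _).trans (add_le_add (g.norm_coe_le_norm _) (g.norm_coe_le_norm _))

theorem map_eq_of_mem_pomega [HasOuterApproxClosed M] [BorelSpace M] {f : M → M}
    (hf : Continuous f) {x : M} {μ : ProbabilityMeasure M} (hμ : μ ∈ pomega f x) :
    μ.map hf.measurable.aemeasurable = μ := by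
  refine ProbabilityMeasure.toMeasure_injective <|
    ext_of_forall_integral_eq_of_IsFiniteMeasure fun g => ?_
  change ∫ y, g y ∂(Measure.map f μ) = ∫ y, g y ∂(μ : Measure M)
  rw [integral_map hf.measurable.aemeasurable g.continuous.aestronglyMeasurable]
  have hcont : Continuous fun ν : ProbabilityMeasure M =>
      ∫ y, g (f y) ∂(ν : Measure M) - ∫ y, g y ∂(ν : Measure M) :=
    (ProbabilityMeasure.continuous_integral_boundedContinuousFunction
      (g.compContinuous ⟨f, hf⟩)).sub
      (ProbabilityMeasure.continuous_integral_boundedContinuousFunction g)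
  exact sub_eq_zero.1 ((MapClusterPt.continuousAt_comp hcont.continuousAt hμ).eq_of_tendsto
    (tendsto_integral_empiric_comp_sub hf x g))

theorem Observable.map_eq [HasOuterApproxClosed M] [BorelSpace M]
    {D : CompatibleMetric (ProbabilityMeasure M)} {m : Measure M} {f : M → M}
    (hf : Continuous f) {μ : ProbabilityMeasure M} (hμ : Observable D m f μ) :
    μ.map hf.measurable.aemeasurable = μ := by
  have hclosed : IsClosed {ν : ProbabilityMeasure M | ν.map hf.measurable.aemeasurable = ν} :=
    isClosed_eq (ProbabilityMeasure.continuous_map hf) continuous_id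
  refine hclosed.closure_subset (D.mem_closure_of_forall_exists_lt fun ε hε => ?_)
  obtain ⟨x, ν, hν, hνμ⟩ := nonempty_of_measure_ne_zero (hμ ε hε).ne'
  exact ⟨ν, map_eq_of_mem_pomega hf hν, hνμ⟩

/-- Theorem (Existence): the set `𝒪` of observable measures of a continuous map is
nonempty and weak*-compact, and every observable measure is `f`-invariant. -/
theorem observable_nonempty_compact_invariant {M : Type*} [MetricSpace M] [CompactSpace M] [MeasurableSpace M] [BorelSpace M]
    (D : CompatibleMetric (ProbabilityMeasure M))
    (m : Measure M) [IsProbabilityMeasure m]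
    (f : M → M) (hf : Continuous f) :
    {μ : ProbabilityMeasure M | Observable D m f μ}.Nonempty ∧
      IsCompact {μ : ProbabilityMeasure M | Observable D m f μ} ∧
      ∀ μ : ProbabilityMeasure M, Observable D m f μ →
        ∀ E : Set M, MeasurableSet E → μ.toMeasure (f ⁻¹' E) = μ.toMeasure E := by
  refine ⟨exists_observable D m f, (isClosed_setOf_observable D m f).isCompact, ?_⟩
  intro μ hμ E hE
  rw [← Measure.map_apply hf.measurable hE]
  exact congrArg (fun ν : ProbabilityMeasure M => (ν : Measure M) E) (hμ.map_eq hf)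
end

section
/- A nonempty weak*-compact subset 𝒜 ⊆ 𝒪 is a generalized attractor for f if and only if there exists a (not necessarily f-invariant) set K ⊆ M with m(K) > 0 such that dist*(σ_{n,x}, 𝒜) → 0 as n → ∞ uniformly in x ∈ K. -/
open MeasureTheory Filter Set Topology
open scoped ENNReal NNReal

variable {M : Type*} [MeasurableSpace M] [TopologicalSpace M] [OpensMeasurableSpace M]

/-- In a compact space, the distance to a closed set tends to zero exactly when all cluster
points lie in that set. -/
theorem tendsto_infDist_zero_iff_mapClusterPt {X ι : Type*} [PseudoMetricSpace X] [CompactSpace X]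
    {A : Set X} (hA : IsClosed A) (hne : A.Nonempty) {l : Filter ι} {u : ι → X} :
    Tendsto (fun i => Metric.infDist (u i) A) l (𝓝 0) ↔ ∀ y, MapClusterPt y l u → y ∈ A := by
  constructor
  · intro h y hy
    have hy' := hy.continuousAt_comp (Metric.continuous_infDist_pt A).continuousAt
    rw [hA.mem_iff_infDist_zero hne]
    exact eq_of_nhds_neBot (hy'.clusterPt.mono h)
  · intro h
    have hu : Tendsto u l (𝓝ˢ A) :=
      isCompact_univ.tendsto_nhdsSet_of_mapClusterPt (by simp) fun y _ hy => h y hy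
    have h0 : Tendsto (fun y => Metric.infDist y A) (𝓝ˢ A) (𝓝 0) :=
      (Metric.continuous_infDist_pt A).tendsto_nhdsSet_nhds fun y hy => Metric.infDist_zero_of_mem hy
    exact h0.comp hu

/-- The pseudometric space structure given by a compatible metric; its topology is
definitionally the given one. -/
noncomputable abbrev CompatibleMetric.toPseudoMetricSpace {P : Type*} [TopologicalSpace P]
    (D : CompatibleMetric P) : PseudoMetricSpace P :=
  let s : PseudoMetricSpace P :=
    { dist := D.d
      dist_self := fun x => (D.eq_iff_dist_eq_zero x x).2 rfl
      dist_comm := D.symm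
      dist_triangle := D.triangle }
  s.replaceTopology <| TopologicalSpace.ext_nhds fun x => by
    ext t
    rw [D.nhds_iff, Metric.mem_nhds_iff]
    simp only [Metric.ball, dist_comm _ x]
    rfl

theorem continuous_empiric {M : Type*} [TopologicalSpace M] [MeasurableSpace M]
    [OpensMeasurableSpace M] {f : M → M} (hf : Continuous f) (n : ℕ) :
    Continuous fun x => empiric f x n := by
  rw [continuous_iff_continuousAt]
  intro x
  rw [ContinuousAt, ProbabilityMeasure.tendsto_iff_forall_lintegral_tendsto]
  intro g
  have (y : M) : ∫⁻ z, g z ∂(empiric f y n : Measure M) =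
      ((n : ℝ≥0∞) + 1)⁻¹ * ∑ j ∈ Finset.range (n + 1), (g (f^[j] y) : ℝ≥0∞) := by
    have hg : Measurable fun z => (g z : ℝ≥0∞) := by fun_prop
    simp [empiric, lintegral_dirac' _ hg]
  simp only [this]
  refine ENNReal.Tendsto.const_mul ?_ (Or.inr (by simp))
  refine tendsto_finsetSum _ fun j _ => ?_
  exact (ENNReal.continuous_coe.comp (g.continuous.comp (hf.iterate j))).tendsto x

/-- Generalized attractors and uniform convergence: a nonempty compact `𝒜 ⊆ 𝒪` is a
generalized attractor iff `dist*(σ_n(x), 𝒜) → 0` uniformly on some set `K` of positive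
`m`-measure. -/
theorem genAttractor_iff_uniform_convergence {M : Type*} [MetricSpace M] [CompactSpace M] [MeasurableSpace M] [BorelSpace M]
    (D : CompatibleMetric (ProbabilityMeasure M))
    (m : Measure M) [IsProbabilityMeasure m]
    (f : M → M) (hf : Continuous f)
    (A : Set (ProbabilityMeasure M)) (hne : A.Nonempty) (hcomp : IsCompact A)
    (hobs : ∀ μ ∈ A, Observable D m f μ) :
    GenAttractor D m f A ↔
      ∃ K : Set M, 0 < m K ∧
        ∀ ε > 0, ∃ N : ℕ, ∀ n ≥ N, ∀ x ∈ K, ∃ ν ∈ A, D.d (empiric f x n) ν < ε := by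
  let _ := D.toPseudoMetricSpace
  have hA : IsClosed A := hcomp.isClosed
  have hbasin : basin f A =
      {x | Tendsto (fun n => Metric.infDist (empiric f x n) A) atTop (𝓝 0)} := by
    ext x
    exact (tendsto_infDist_zero_iff_mapClusterPt hA hne).symm
  have hunif (K : Set M) : (∀ ε > 0, ∃ N : ℕ, ∀ n ≥ N, ∀ x ∈ K,
      ∃ ν ∈ A, D.d (empiric f x n) ν < ε) ↔ TendstoUniformlyOn
        (fun n x => Metric.infDist (empiric f x n) A) (fun _ => 0) atTop K := by
    simp_rw [Metric.tendstoUniformlyOn_iff, eventually_atTop, dist_zero_left, Real.norm_eq_abs,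
      abs_of_nonneg Metric.infDist_nonneg, Metric.infDist_lt_iff hne]
    rfl
  simp_rw [hunif]
  constructor
  · rintro ⟨-, -, -, hpos⟩
    have hmeas (n : ℕ) : StronglyMeasurable fun x => Metric.infDist (empiric f x n) A :=
      ((Metric.continuous_infDist_pt A).comp (continuous_empiric hf n)).stronglyMeasurable
    have hbm : MeasurableSet (basin f A) := by
      rw [hbasin]
      exact measurableSet_tendsto _ fun n => (hmeas n).measurable
    obtain ⟨ε, hε, hεm⟩ : ∃ ε : ℝ, 0 < ε ∧ ENNReal.ofReal ε < m (basin f A) := by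
      obtain ⟨r, hr, hrm⟩ := ENNReal.lt_iff_exists_nnreal_btwn.1 hpos
      exact ⟨r, by simpa using hr, by simpa using hrm⟩
    obtain ⟨t, -, -, htm, ht⟩ := tendstoUniformlyOn_of_ae_tendsto hmeas
      (stronglyMeasurable_const (b := (0 : ℝ))) hbm (measure_ne_top m _)
      (ae_of_all _ fun x hx => by rwa [hbasin] at hx) hε
    exact ⟨basin f A \ t, (tsub_pos_of_lt (htm.trans_lt hεm)).trans_le le_measure_sdiff, ht⟩
  · rintro ⟨K, hK, hKu⟩
    refine ⟨hne, hcomp, hobs, hK.trans_le (measure_mono fun x hx => ?_)⟩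
    rw [hbasin]
    exact hKu.tendsto_at hx
end

section
/- Suppose f preserves the reference measure m (m is f-invariant). Then the following assertions are equivalent: (i) f is ergodic with respect to m; (ii) f has a unique observable measure μ; (iii) f has a physical measure ν whose basin of attraction has full m-measure. Moreover, if these assertions hold, then m = μ = ν. -/
open MeasureTheory Filter Set Topology
open scoped ENNReal NNReal

variable {M : Type*} [MeasurableSpace M] [TopologicalSpace M] [OpensMeasurableSpace M]

section BirkhoffBound

/-- The maximum of the Birkhoff sums of `φ` along `f` over the lengths `1, …, n + 1`. -/
def maxBirkhoffSum {α : Type*} (f : α → α) (φ : α → ℝ) : ℕ → α → ℝ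
  | 0 => φ
  | n + 1 => fun x => φ x + max 0 (maxBirkhoffSum f φ n (f x))

variable {α : Type*} {f : α → α} {φ : α → ℝ}

theorem monotone_maxBirkhoffSum (f : α → α) (φ : α → ℝ) (x : α) :
    Monotone fun n => maxBirkhoffSum f φ n x := by
  refine monotone_nat_of_le_succ fun n => ?_
  induction n generalizing x with
  | zero => simp [maxBirkhoffSum]
  | succ n ih =>
    simp only [maxBirkhoffSum] at ih ⊢
    exact add_le_add_right (max_le_max_left 0 (ih (f x))) _

theorem birkhoffSum_succ_le_maxBirkhoffSum (f : α → α) (φ : α → ℝ) (n : ℕ) (x : α) :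
    birkhoffSum f φ (n + 1) x ≤ maxBirkhoffSum f φ n x := by
  induction n generalizing x with
  | zero => simp [maxBirkhoffSum]
  | succ n ih =>
    rw [birkhoffSum_succ', maxBirkhoffSum]
    exact add_le_add_right ((ih (f x)).trans (le_max_right _ _)) _

theorem abs_maxBirkhoffSum_le {C : ℝ} (hC : ∀ x, |φ x| ≤ C) (n : ℕ) (x : α) :
    |maxBirkhoffSum f φ n x| ≤ (n + 1) * C := by
  induction n generalizing x with
  | zero => simpa [maxBirkhoffSum] using hC x
  | succ n ih =>
    have h₁ := abs_le.1 (hC x)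
    have h₂ := abs_le.1 (ih (f x))
    have h₃ : max 0 (maxBirkhoffSum f φ n (f x)) ≤ (n + 1) * C :=
      max_le ((abs_nonneg _).trans (ih (f x))) h₂.2
    have h₄ := le_max_left 0 (maxBirkhoffSum f φ n (f x))
    simp only [maxBirkhoffSum]
    push_cast
    rw [abs_le]
    constructor <;> nlinarith [(abs_nonneg _).trans (ih (f x))]

theorem bddAbove_range_maxBirkhoffSum_map (f : α → α) (φ : α → ℝ) (x : α) :
    BddAbove (range fun n => maxBirkhoffSum f φ n (f x)) ↔
      BddAbove (range fun n => maxBirkhoffSum f φ n x) := by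
  constructor
  · rintro ⟨b, hb⟩
    refine ⟨φ x + max 0 b, ?_⟩
    rintro _ ⟨n, rfl⟩
    refine (monotone_maxBirkhoffSum f φ x n.le_succ).trans ?_
    simp only [maxBirkhoffSum]
    gcongr
    exact hb ⟨n, rfl⟩
  · rintro ⟨b, hb⟩
    refine ⟨b - φ x, ?_⟩
    rintro _ ⟨n, rfl⟩
    have h : maxBirkhoffSum f φ (n + 1) x ≤ b := hb ⟨n + 1, rfl⟩
    have := le_max_right 0 (maxBirkhoffSum f φ n (f x))
    simp only [maxBirkhoffSum] at h ⊢
    linarith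

theorem measurable_maxBirkhoffSum [MeasurableSpace α] (hf : Measurable f) (hφ : Measurable φ)
    (n : ℕ) : Measurable (maxBirkhoffSum f φ n) := by
  induction n with
  | zero => exact hφ
  | succ n ih => exact hφ.add (measurable_const.max (ih.comp hf))

variable [MeasurableSpace α] {μ : Measure α} [IsProbabilityMeasure μ] {C : ℝ}

theorem Ergodic.ae_bddAbove_maxBirkhoffSum (hf : Ergodic f μ) (hφ : Measurable φ)
    (hC : ∀ x, |φ x| ≤ C) (hneg : ∫ x, φ x ∂μ < 0) :
    ∀ᵐ x ∂μ, BddAbove (range fun n => maxBirkhoffSum f φ n x) := by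
  have hmeas := measurable_maxBirkhoffSum hf.measurable hφ
  have hint : ∀ n, Integrable (maxBirkhoffSum f φ n) μ := fun n =>
    .of_bound (hmeas n).aestronglyMeasurable _ (ae_of_all _ (abs_maxBirkhoffSum_le hC n))
  refine (hf.ae_mem_or_ae_notMem (measurableSet_bddAbove_range hmeas)
    (Set.ext fun x => bddAbove_range_maxBirkhoffSum_map f φ x)).resolve_right fun hunbdd => ?_
  have hdiff : ∀ n x, maxBirkhoffSum f φ (n + 1) x - maxBirkhoffSum f φ n (f x) =
      φ x + max 0 (-maxBirkhoffSum f φ n (f x)) := fun n x => by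
    simp only [maxBirkhoffSum]
    rcases le_total 0 (maxBirkhoffSum f φ n (f x)) with h | h
    · rw [max_eq_right h, max_eq_left (by linarith)]; ring
    · rw [max_eq_left h, max_eq_right (by linarith)]; ring
  have hnonneg : ∀ n, 0 ≤ ∫ x, φ x + max 0 (-maxBirkhoffSum f φ n (f x)) ∂μ := fun n => by
    simp_rw [← hdiff]
    rw [integral_sub (f := maxBirkhoffSum f φ (n + 1)) (g := fun x => maxBirkhoffSum f φ n (f x))
        (hint _) (hf.toMeasurePreserving.integrable_comp_of_integrable (hint n)),
      ← integral_map hf.measurable.aemeasurable (hmeas n).aestronglyMeasurable, hf.map_eq,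
      sub_nonneg]
    exact integral_mono (hint n) (hint _) fun x => monotone_maxBirkhoffSum f φ x n.le_succ
  have hlim : Tendsto (fun n => ∫ x, φ x + max 0 (-maxBirkhoffSum f φ n (f x)) ∂μ) atTop
      (𝓝 (∫ x, φ x ∂μ)) := by
    refine tendsto_integral_of_dominated_convergence (fun _ => C + C)
      (fun n => (hφ.add (measurable_const.max
        ((hmeas n).comp hf.measurable).neg)).aestronglyMeasurable)
      (integrable_const _) (fun n => ae_of_all _ fun x => ?_) ?_
    · have h₁ := hC x
      have h₂ : -maxBirkhoffSum f φ n (f x) ≤ C :=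
        (neg_le_neg (monotone_maxBirkhoffSum f φ (f x) n.zero_le)).trans
          ((neg_le_abs _).trans (hC (f x)))
      refine (norm_add_le _ _).trans (add_le_add h₁ ?_)
      rw [Real.norm_of_nonneg (le_max_left _ _)]
      exact max_le ((abs_nonneg _).trans h₁) h₂
    · filter_upwards [hunbdd] with x (hx : ¬ BddAbove _)
      rw [← bddAbove_range_maxBirkhoffSum_map] at hx
      obtain ⟨_, ⟨N, rfl⟩, hN⟩ := not_bddAbove_iff.1 hx 0
      refine tendsto_const_nhds.congr' ?_
      filter_upwards [eventually_ge_atTop N] with n hn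
      have : maxBirkhoffSum f φ N (f x) ≤ maxBirkhoffSum f φ n (f x) :=
        monotone_maxBirkhoffSum f φ (f x) hn
      rw [max_eq_left (by linarith), add_zero]
  exact hneg.not_ge (ge_of_tendsto' hlim hnonneg)

theorem Ergodic.ae_eventually_birkhoffAverage_lt (hf : Ergodic f μ) (hφ : Measurable φ)
    (hC : ∀ x, |φ x| ≤ C) {a : ℝ} (ha : ∫ x, φ x ∂μ < a) :
    ∀ᵐ x ∂μ, ∀ᶠ n : ℕ in atTop, birkhoffAverage ℝ f φ (n + 1) x < a := by
  obtain ⟨b, hb, hba⟩ := exists_between ha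
  have hφint : Integrable φ μ := .of_bound hφ.aestronglyMeasurable C (ae_of_all _ hC)
  have hneg : ∫ x, φ x - b ∂μ < 0 := by
    rw [integral_sub hφint (integrable_const _)]
    simpa using hb
  filter_upwards [hf.ae_bddAbove_maxBirkhoffSum (hφ.sub_const b)
    (fun x => (abs_sub (φ x) b).trans (add_le_add_left (hC x) |b|)) hneg] with x ⟨B, hB⟩
  obtain ⟨N, hN⟩ := exists_nat_gt (B / (a - b))
  filter_upwards [eventually_ge_atTop N] with n hn
  have hsum : birkhoffSum f φ (n + 1) x - (n + 1) * b ≤ B := by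
    refine le_trans (le_of_eq ?_) ((birkhoffSum_succ_le_maxBirkhoffSum f (φ · - b) n x).trans
      (hB ⟨n, rfl⟩))
    simp [birkhoffSum, Finset.sum_sub_distrib]
  have hn' : (N : ℝ) ≤ n := by exact_mod_cast hn
  rw [div_lt_iff₀ (by linarith)] at hN
  rw [birkhoffAverage, smul_eq_mul, inv_mul_lt_iff₀ (by positivity)]
  push_cast
  nlinarith

/-- The pointwise ergodic theorem for a bounded observable of an ergodic map. -/
theorem Ergodic.ae_tendsto_birkhoffAverage (hf : Ergodic f μ) (hφ : Measurable φ)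
    (hC : ∀ x, |φ x| ≤ C) :
    ∀ᵐ x ∂μ, Tendsto (fun n : ℕ => birkhoffAverage ℝ f φ (n + 1) x) atTop
      (𝓝 (∫ x, φ x ∂μ)) := by
  have upper : ∀ ψ : α → ℝ, Measurable ψ → (∀ x, |ψ x| ≤ C) → ∀ᵐ x ∂μ, ∀ k : ℕ,
      ∀ᶠ n : ℕ in atTop, birkhoffAverage ℝ f ψ (n + 1) x < ∫ x, ψ x ∂μ + 1 / (k + 1) :=
    fun ψ hψ hψC => ae_all_iff.2 fun k =>
      hf.ae_eventually_birkhoffAverage_lt hψ hψC (lt_add_of_pos_right _ Nat.one_div_pos_of_nat)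
  filter_upwards [upper φ hφ hC, upper (-φ) hφ.neg fun x => by simpa using hC x]
    with x hx hx'
  refine tendsto_order.2 ⟨fun a ha => ?_, fun a ha => ?_⟩
  · obtain ⟨k, hk⟩ := exists_nat_one_div_lt (sub_pos.2 ha)
    filter_upwards [hx' k] with n hn
    rw [birkhoffAverage_neg] at hn
    simp only [Pi.neg_apply, integral_neg] at hn
    linarith
  · obtain ⟨k, hk⟩ := exists_nat_one_div_lt (sub_pos.2 ha)
    filter_upwards [hx k] with n hn
    linarith

end BirkhoffBound

section Empiric

theorem measurable_birkhoffAverage {Y : Type*} [TopologicalSpace Y] [MeasurableSpace Y]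
    [OpensMeasurableSpace Y] {f : Y → Y} (hf : Continuous f) (φ : C(Y, ℝ)) (n : ℕ) :
    Measurable (birkhoffAverage ℝ f φ n) := by
  have : Continuous fun x => (n : ℝ)⁻¹ • ∑ k ∈ Finset.range n, φ (f^[k] x) := by
    have := hf.iterate
    fun_prop
  exact this.measurable

variable {X : Type*} [MetricSpace X] [CompactSpace X] [MeasurableSpace X] [BorelSpace X]

theorem integrable_continuousMap (μ : Measure X) [IsFiniteMeasure μ] (φ : C(X, ℝ)) :
    Integrable φ μ :=
  φ.continuous.integrable_of_hasCompactSupport (HasCompactSupport.of_compactSpace _)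

theorem integral_empiric_s8 (f : X → X) (x : X) (n : ℕ) (φ : C(X, ℝ)) :
    ∫ y, φ y ∂(empiric f x n).toMeasure = birkhoffAverage ℝ f φ (n + 1) x := by
  change ∫ y, φ y ∂(((n : ℝ≥0∞) + 1)⁻¹ • ∑ j ∈ Finset.range (n + 1), Measure.dirac (f^[j] x)) = _
  rw [integral_smul_measure, integral_finsetSum_measure fun _ _ => integrable_continuousMap _ φ]
  simp only [integral_dirac, birkhoffAverage, birkhoffSum]
  congr 1
  rw [ENNReal.toReal_inv, ENNReal.toReal_add (by simp) (by simp)]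
  simp

theorem continuous_integral_continuousMap (φ : C(X, ℝ)) :
    Continuous fun μ : ProbabilityMeasure X => ∫ x, φ x ∂μ.toMeasure :=
  ProbabilityMeasure.continuous_integral_boundedContinuousFunction
    (BoundedContinuousFunction.mkOfCompact φ)

theorem tendsto_probabilityMeasure_of_dense {s : Set C(X, ℝ)} (hs : Dense s)
    {u : ℕ → ProbabilityMeasure X} {ν : ProbabilityMeasure X}
    (h : ∀ φ ∈ s, Tendsto (fun n => ∫ x, φ x ∂(u n).toMeasure) atTop
      (𝓝 (∫ x, φ x ∂ν.toMeasure))) :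
    Tendsto u atTop (𝓝 ν) := by
  refine tendsto_nhds_of_unique_mapClusterPt fun κ hκ => ?_
  have hcont : ∀ μ : ProbabilityMeasure X,
      Continuous fun φ : C(X, ℝ) => ∫ x, φ x ∂μ.toMeasure := fun μ => by
    refine (LipschitzWith.of_dist_le_mul (K := 1) fun φ ψ => ?_).continuous
    rw [Real.dist_eq, ← integral_sub (integrable_continuousMap _ φ) (integrable_continuousMap _ ψ)]
    simpa [dist_eq_norm] using norm_integral_le_of_norm_le_const (μ := μ.toMeasure)
      (ae_of_all _ (φ - ψ).norm_coe_le_norm)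
  have heq : (fun φ : C(X, ℝ) => ∫ x, φ x ∂κ.toMeasure) = fun φ => ∫ x, φ x ∂ν.toMeasure := by
    refine (hcont κ).ext_on hs (hcont ν) fun φ hφ => ?_
    have := hκ.continuousAt_comp (continuous_integral_continuousMap φ).continuousAt
    exact eq_of_nhds_neBot (NeBot.mono this (inf_le_inf_left _ (h φ hφ)))
  have := κ.2
  have := ν.2
  refine Subtype.ext (ext_of_forall_integral_eq_of_IsFiniteMeasure fun φ => ?_)
  exact congrFun heq φ.toContinuousMap

theorem Ergodic.ae_tendsto_empiric {f : X → X} {μ : ProbabilityMeasure X}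
    (hf : Ergodic f μ.toMeasure) :
    ∀ᵐ x ∂μ.toMeasure, Tendsto (empiric f x) atTop (𝓝 μ) := by
  obtain ⟨s, hs, hsd⟩ := TopologicalSpace.exists_countable_dense C(X, ℝ)
  have h : ∀ᵐ x ∂μ.toMeasure, ∀ φ ∈ s,
      Tendsto (fun n : ℕ => birkhoffAverage ℝ f φ (n + 1) x) atTop
        (𝓝 (∫ x, φ x ∂μ.toMeasure)) :=
    (ae_ball_iff hs).2 fun φ _ =>
      hf.ae_tendsto_birkhoffAverage φ.continuous.measurable φ.norm_coe_le_norm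
  filter_upwards [h] with x hx
  exact tendsto_probabilityMeasure_of_dense hsd fun φ hφ => by
    simpa only [integral_empiric_s8] using hx φ hφ

theorem measurableSet_tendsto_empiric {f : X → X} (hf : Continuous f) (ν : ProbabilityMeasure X) :
    MeasurableSet {x | Tendsto (empiric f x) atTop (𝓝 ν)} := by
  obtain ⟨s, hs, hsd⟩ := TopologicalSpace.exists_countable_dense C(X, ℝ)
  have : {x | Tendsto (empiric f x) atTop (𝓝 ν)} = ⋂ φ ∈ s,
      {x | Tendsto (fun n : ℕ => birkhoffAverage ℝ f φ (n + 1) x) atTop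
        (𝓝 (∫ y, φ y ∂ν.toMeasure))} := by
    ext x
    simp only [mem_iInter, mem_ofPred_eq, ← integral_empiric_s8]
    exact ⟨fun h φ _ => ((continuous_integral_continuousMap φ).tendsto ν).comp h,
      tendsto_probabilityMeasure_of_dense hsd⟩
  rw [this]
  exact .biInter hs fun φ _ => measurableSet_tendsto _ fun n => measurable_birkhoffAverage hf φ _

theorem MeasureTheory.MeasurePreserving.integral_birkhoffAverage {f : X → X} {μ : Measure X}
    [IsFiniteMeasure μ] (hf : MeasurePreserving f μ μ) (hfc : Continuous f) (φ : C(X, ℝ)) (n : ℕ) :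
    ∫ x, birkhoffAverage ℝ f φ (n + 1) x ∂μ = ∫ x, φ x ∂μ := by
  have hk : ∀ k, ∫ x, φ (f^[k] x) ∂μ = ∫ x, φ x ∂μ := fun k => by
    rw [← integral_map (hf.iterate k).measurable.aemeasurable
      φ.continuous.measurable.aestronglyMeasurable, (hf.iterate k).map_eq]
  simp only [birkhoffAverage, birkhoffSum]
  rw [integral_smul, integral_finsetSum (f := fun k x => φ (f^[k] x)) _ fun k _ =>
    integrable_continuousMap μ (φ.comp ⟨_, hfc.iterate k⟩)]
  simp only [hk, Finset.sum_const, Finset.card_range, nsmul_eq_mul, smul_eq_mul]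
  field_simp

/-- An invariant finite measure almost all of whose points have empirical measures converging to
`ν` is a multiple of `ν`. -/
theorem MeasureTheory.MeasurePreserving.eq_smul_of_ae_tendsto_empiric {f : X → X} {μ : Measure X}
    [IsFiniteMeasure μ] (hf : MeasurePreserving f μ μ) (hfc : Continuous f)
    {ν : ProbabilityMeasure X} (h : ∀ᵐ x ∂μ, Tendsto (empiric f x) atTop (𝓝 ν)) :
    μ = μ univ • ν.toMeasure := by
  have : IsFiniteMeasure (μ univ • ν.toMeasure) := Measure.smul_finite _ (measure_ne_top _ _)
  refine ext_of_forall_integral_eq_of_IsFiniteMeasure fun φ => ?_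
  have hlim : Tendsto (fun n => ∫ x, birkhoffAverage ℝ f φ.toContinuousMap (n + 1) x ∂μ) atTop
      (𝓝 (∫ _, ∫ y, φ y ∂ν.toMeasure ∂μ)) := by
    refine tendsto_integral_of_dominated_convergence (fun _ => ‖φ‖)
      (fun n => (measurable_birkhoffAverage hfc _ _).aestronglyMeasurable)
      (integrable_const _) (fun n => ae_of_all _ fun x => ?_) ?_
    · rw [← integral_empiric_s8]
      simpa using norm_integral_le_of_norm_le_const (μ := (empiric f x n).toMeasure)
        (ae_of_all _ φ.norm_coe_le_norm)
    · filter_upwards [h] with x hx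
      simp only [← integral_empiric_s8]
      exact ((continuous_integral_continuousMap φ.toContinuousMap).tendsto ν).comp hx
  simp only [hf.integral_birkhoffAverage hfc] at hlim
  rw [integral_smul_measure]
  simpa [Measure.real] using tendsto_nhds_unique tendsto_const_nhds hlim

theorem ergodic_of_ae_tendsto_empiric {f : X → X} {μ : Measure X} [IsProbabilityMeasure μ]
    (hf : MeasurePreserving f μ μ) (hfc : Continuous f) {ν : ProbabilityMeasure X}
    (h : ∀ᵐ x ∂μ, Tendsto (empiric f x) atTop (𝓝 ν)) : Ergodic f μ := by
  refine ⟨hf, ⟨fun s hs hfs => ?_⟩⟩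
  have hν : μ = ν.toMeasure := by simpa using hf.eq_smul_of_ae_tendsto_empiric hfc h
  have hfr : MeasurePreserving f (μ.restrict s) (μ.restrict s) := by
    simpa only [hfs] using hf.restrict_preimage hs
  have hs_eq := congrArg (· s) (hfr.eq_smul_of_ae_tendsto_empiric hfc (ae_restrict_of_ae h))
  rw [← hν] at hs_eq
  simp only [Measure.restrict_apply_self, Measure.restrict_apply_univ, Measure.smul_apply,
    smul_eq_mul] at hs_eq
  rw [eventuallyConst_set']
  by_cases h₀ : μ s = 0
  · exact .inl (ae_eq_empty.2 h₀)
  · refine .inr (ae_eq_univ.2 ((prob_compl_eq_zero_iff hs).2 ?_))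
    exact (ENNReal.mul_eq_left h₀ (measure_ne_top _ _)).1 hs_eq.symm

theorem pomega_eq_singleton_iff {f : X → X} {x : X} {ν : ProbabilityMeasure X} :
    pomega f x = {ν} ↔ Tendsto (empiric f x) atTop (𝓝 ν) := by
  refine ⟨fun h => tendsto_nhds_of_unique_mapClusterPt fun κ hκ => ?_, fun h => ?_⟩
  · exact h.subset hκ
  · exact Set.ext fun κ => ⟨fun hκ => eq_of_nhds_neBot (NeBot.mono hκ (inf_le_inf_left _ h)),
      fun hκ => hκ ▸ h.mapClusterPt⟩

theorem measure_pomega_eq_one_iff {f : X → X} (hf : Continuous f) {μ : Measure X}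
    [IsProbabilityMeasure μ] {ν : ProbabilityMeasure X} :
    μ {x | pomega f x = {ν}} = 1 ↔ ∀ᵐ x ∂μ, Tendsto (empiric f x) atTop (𝓝 ν) := by
  simp only [pomega_eq_singleton_iff]
  exact (mem_ae_iff_prob_eq_one (measurableSet_tendsto_empiric hf ν)).symm

variable (D : CompatibleMetric (ProbabilityMeasure X)) {f : X → X} {μ : Measure X}
  {ν : ProbabilityMeasure X}

theorem observable_iff_eq_of_ae_tendsto_empiric [IsProbabilityMeasure μ]
    (h : ∀ᵐ x ∂μ, Tendsto (empiric f x) atTop (𝓝 ν)) {κ : ProbabilityMeasure X} :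
    Observable D μ f κ ↔ κ = ν := by
  have hset : ∀ ε, {x | ∃ ν' ∈ pomega f x, D.d ν' κ < ε} =ᵐ[μ] {_x | D.d ν κ < ε} := fun ε => by
    filter_upwards [h] with x hx
    refine propext ?_
    change (∃ ν' ∈ pomega f x, D.d ν' κ < ε) ↔ D.d ν κ < ε
    simp [pomega_eq_singleton_iff.2 hx]
  simp only [Observable, fun ε => measure_congr (hset ε)]
  constructor
  · intro hκ
    have hle : D.d ν κ ≤ 0 := le_of_forall_pos_lt_add fun ε hε => by
      obtain ⟨_, hlt⟩ := nonempty_of_measure_ne_zero (hκ ε hε).ne'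
      simpa using hlt
    have h₀ := D.triangle ν κ ν
    rw [D.symm κ ν, (D.eq_iff_dist_eq_zero ν ν).2 rfl] at h₀
    exact ((D.eq_iff_dist_eq_zero ν κ).1 (by linarith)).symm
  · rintro rfl ε hε
    simp [(D.eq_iff_dist_eq_zero κ κ).2 rfl, hε]

theorem ae_tendsto_empiric_of_forall_observable_eq (h : ∀ κ, Observable D μ f κ → κ = ν) :
    ∀ᵐ x ∂μ, Tendsto (empiric f x) atTop (𝓝 ν) := by
  let := TopologicalSpace.metrizableSpaceMetric (ProbabilityMeasure X)
  have hnull : ∀ κ ∈ ({ν}ᶜ : Set (ProbabilityMeasure X)), ∃ U ∈ 𝓝 κ,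
      ∀ᵐ x ∂μ, Disjoint (pomega f x) U := fun κ hκ => by
    have := mt (h κ) hκ
    simp only [Observable, not_forall, not_lt, nonpos_iff_eq_zero] at this
    obtain ⟨ε, hε, h₀⟩ := this
    refine ⟨{κ' | D.d κ κ' < ε}, (D.nhds_iff κ _).2 ⟨ε, hε, Subset.rfl⟩, ?_⟩
    filter_upwards [measure_eq_zero_iff_ae_notMem.1 h₀] with x hx
    refine disjoint_left.2 fun κ' hκ' hd => hx ⟨κ', hκ', ?_⟩
    rwa [D.symm]
  choose! U hU hUnull using hnull
  obtain ⟨t, ht, htν, htU⟩ := (HereditarilyLindelofSpace.isLindelof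
    ({ν}ᶜ : Set (ProbabilityMeasure X))).elim_nhds_subcover U hU
  filter_upwards [(ae_ball_iff ht).2 fun κ hκ => hUnull κ (htν κ hκ)] with x hx
  refine tendsto_nhds_of_unique_mapClusterPt fun κ hκ => by_contra fun hne => ?_
  obtain ⟨κ', hκ', hmem⟩ := mem_iUnion₂.1 (htU hne)
  exact disjoint_left.1 (hx κ' hκ') hκ hmem

end Empiric

/-- Observability and ergodicity: if `f` preserves `m`, then ergodicity of `m`,
uniqueness of the observable measure, and existence of a physical measure with full basin
are all equivalent; in that case the observable and physical measures equal `m`. -/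
theorem ergodic_iff_unique_observable {M : Type*} [MetricSpace M] [CompactSpace M] [MeasurableSpace M] [BorelSpace M]
    (D : CompatibleMetric (ProbabilityMeasure M))
    (m : Measure M) [IsProbabilityMeasure m]
    (f : M → M) (hf : Continuous f)
    (hm : MeasurePreserving f m m) :
    ((Ergodic f m ↔ ∃! μ : ProbabilityMeasure M, Observable D m f μ) ∧
      (Ergodic f m ↔ ∃ ν : ProbabilityMeasure M, m {x | pomega f x = {ν}} = 1)) ∧
    (Ergodic f m →
      (∀ μ : ProbabilityMeasure M, Observable D m f μ → μ.toMeasure = m) ∧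
      (∀ ν : ProbabilityMeasure M, m {x | pomega f x = {ν}} = 1 → ν.toMeasure = m)) := by
  have hconv (he : Ergodic f m) : ∀ᵐ x ∂m, Tendsto (empiric f x) atTop (𝓝 ⟨m, ‹_›⟩) :=
    Ergodic.ae_tendsto_empiric (μ := ⟨m, ‹_›⟩) he
  have hobs (he : Ergodic f m) (μ : ProbabilityMeasure M) :
      Observable D m f μ ↔ μ = ⟨m, ‹_›⟩ :=
    observable_iff_eq_of_ae_tendsto_empiric D (hconv he)
  refine ⟨⟨⟨fun he => ⟨_, (hobs he _).2 rfl, fun μ => (hobs he μ).1⟩, ?_⟩, ?_, ?_⟩,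
    fun he => ⟨fun μ hμ => congrArg _ ((hobs he μ).1 hμ), fun ν hν => ?_⟩⟩
  · rintro ⟨μ, -, hμ⟩
    exact ergodic_of_ae_tendsto_empiric hm hf (ae_tendsto_empiric_of_forall_observable_eq D hμ)
  · exact fun he => ⟨_, (measure_pomega_eq_one_iff hf).2 (hconv he)⟩
  · rintro ⟨ν, hν⟩
    exact ergodic_of_ae_tendsto_empiric hm hf ((measure_pomega_eq_one_iff hf).1 hν)
  · simpa using (hm.eq_smul_of_ae_tendsto_empiric hf ((measure_pomega_eq_one_iff hf).1 hν)).symm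
end
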